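/- arXiv:2503.22335 — 6 statements merged into one kernel-verified Lean document; each statement's English description precedes it below -/
import Mathlib

section
/- Let f : [a,b] → ℝ be continuous, let A be a knot collection of size k+1 on [a,b], let h = max_{0≤i≤k} (t_{i+1} − t_i) be the maximum knot size, and let q ∈ ℕ, q ≥ 1. Then for all t ∈ [a,b], the Bernstein spline operator satisfies |f(t) − (S^q_A f)(t)| ≤ (5/4) · ω(f; h/√q). -/
/-- Bernstein operator of order `q` for `f` on the interval `[a, b]`. -/
noncomputable def bern (a b : ℝ) (q : ℕ) (f : ℝ → ℝ) (t : ℝ) : ℝ :=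
  ∑ j ∈ Finset.range (q + 1),
    f (a + (j : ℝ) * (b - a) / (q : ℝ)) * (q.choose j : ℝ) *
      ((t - a) / (b - a)) ^ j * ((b - t) / (b - a)) ^ (q - j)

/-- The `i`-th knot interval of a knot collection of size `k+1` with knots `tk`:
half-open `[t_i, t_{i+1})` for `i < k`, closed `[t_k, t_{k+1}]` for `i = k`. -/
def knotSet (tk : ℕ → ℝ) (k i : ℕ) : Set ℝ :=
  if i < k then Set.Ico (tk i) (tk (i + 1)) else Set.Icc (tk i) (tk (i + 1))

/-- Bernstein spline operator of order `q` on a knot collection of size `k+1`. -/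
noncomputable def spline (tk : ℕ → ℝ) (k q : ℕ) (f : ℝ → ℝ) (t : ℝ) : ℝ :=
  ∑ i ∈ Finset.range (k + 1),
    (knotSet tk k i).indicator (bern (tk i) (tk (i + 1)) q f) t

/-- Modulus of continuity of `f` on `[a,b]`. -/
noncomputable def modCont (f : ℝ → ℝ) (a b δ : ℝ) : ℝ :=
  sSup {v | ∃ s t, s ∈ Set.Icc a b ∧ t ∈ Set.Icc a b ∧ |t - s| ≤ δ ∧ v = |f t - f s|}

lemma mod_bdd (f : ℝ → ℝ) (a b δ : ℝ) (hf : ContinuousOn f (Set.Icc a b)) :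
    BddAbove {v | ∃ s t, s ∈ Set.Icc a b ∧ t ∈ Set.Icc a b ∧ |t - s| ≤ δ ∧ v = |f t - f s|} := by
  obtain ⟨C, hC⟩ := isCompact_Icc.exists_bound_of_continuousOn hf
  refine ⟨C + C, ?_⟩
  rintro v ⟨s, t, hs, ht, -, rfl⟩
  have h1 := hC s hs
  have h2 := hC t ht
  rw [Real.norm_eq_abs] at h1 h2
  exact (abs_sub _ _).trans (add_le_add h2 h1)

lemma step_bound (f : ℝ → ℝ) (a b δ : ℝ) (hf : ContinuousOn f (Set.Icc a b)) (n : ℕ) :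
    ∀ s t, s ∈ Set.Icc a b → t ∈ Set.Icc a b → |t - s| ≤ (n + 1) * δ →
      |f t - f s| ≤ (n + 1) * modCont f a b δ := by
  induction n with
  | zero =>
    intro s t hs ht hst
    have : |f t - f s| ≤ modCont f a b δ :=
      le_csSup (mod_bdd f a b δ hf) ⟨s, t, hs, ht, by simpa using hst, rfl⟩
    simpa using this
  | succ n ih =>
    intro s t hs ht hst
    push_cast at hst ⊢
    have hn : (0 : ℝ) < n + 1 + 1 := by positivity
    set c : ℝ := 1 / (n + 1 + 1) with hc
    have hc0 : 0 ≤ c := by positivity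
    have hc2 : c * (n + 1 + 1) = 1 := by rw [hc]; field_simp
    have hc1 : c ≤ 1 := by rw [hc, div_le_one hn]; nlinarith [(Nat.cast_nonneg n : (0 : ℝ) ≤ n)]
    set u := s + c * (t - s) with hu
    have hus : u ∈ Set.Icc a b := by
      have := convex_Icc a b hs ht (sub_nonneg.2 hc1) hc0 (by ring)
      simp only [smul_eq_mul] at this
      convert this using 1
      rw [hu]; ring
    have e1 : |u - s| ≤ δ := by
      rw [hu, add_sub_cancel_left, abs_mul, abs_of_nonneg hc0]
      calc c * |t - s| ≤ c * ((n + 1 + 1) * δ) := by gcongr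
        _ = (c * (n + 1 + 1)) * δ := by ring
        _ = δ := by rw [hc2, one_mul]
    have e2 : |t - u| ≤ (n + 1) * δ := by
      have : t - u = (1 - c) * (t - s) := by rw [hu]; ring
      rw [this, abs_mul, abs_of_nonneg (sub_nonneg.2 hc1)]
      calc (1 - c) * |t - s| ≤ (1 - c) * ((n + 1 + 1) * δ) := by
            have := sub_nonneg.2 hc1
            gcongr
        _ = (n + 1 + 1) * δ - (c * (n + 1 + 1)) * δ := by ring
        _ = (n + 1) * δ := by rw [hc2]; ring
    have f1 : |f u - f s| ≤ modCont f a b δ :=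
      le_csSup (mod_bdd f a b δ hf) ⟨s, u, hs, hus, e1, rfl⟩
    have f2 := ih u t hus ht e2
    have := abs_sub_le (f t) (f u) (f s)
    linarith

lemma quad_bound (f : ℝ → ℝ) (a b δ : ℝ) (hδ : 0 < δ) (hf : ContinuousOn f (Set.Icc a b))
    (s t : ℝ) (hs : s ∈ Set.Icc a b) (ht : t ∈ Set.Icc a b) (hω : 0 ≤ modCont f a b δ) :
    |f t - f s| ≤ (1 + ((t - s) / δ) ^ 2) * modCont f a b δ := by
  set l := |t - s| / δ with hl
  have hl0 : 0 ≤ l := by positivity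
  have hsq : ((t - s) / δ) ^ 2 = l ^ 2 := by rw [hl, div_pow, div_pow, sq_abs]
  have h1 := step_bound f a b δ hf ⌊l⌋₊ s t hs ht (by
    have := (Nat.lt_floor_add_one l).le
    rwa [hl, div_le_iff₀ hδ, ← hl] at this)
  refine h1.trans (mul_le_mul_of_nonneg_right ?_ hω)
  rw [hsq, add_comm]
  have h2 : (⌊l⌋₊ : ℝ) ≤ l := Nat.floor_le hl0
  rcases lt_or_ge l 1 with h | h
  · rw [Nat.floor_eq_zero.2 h]; simp; positivity
  · nlinarith

lemma bern_w_sum (q : ℕ) (x : ℝ) :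
    ∑ j ∈ Finset.range (q + 1), (q.choose j : ℝ) * x ^ j * (1 - x) ^ (q - j) = 1 := by
  have := congrArg (Polynomial.eval x) (bernsteinPolynomial.sum ℝ q)
  simpa [Polynomial.eval_finset_sum, bernsteinPolynomial] using this

lemma bern_w_var (q : ℕ) (x : ℝ) :
    ∑ j ∈ Finset.range (q + 1), (q * x - j) ^ 2 * ((q.choose j : ℝ) * x ^ j * (1 - x) ^ (q - j))
      = q * x * (1 - x) := by
  have := congrArg (Polynomial.eval x) (bernsteinPolynomial.variance ℝ q)
  simpa [Polynomial.eval_finset_sum, bernsteinPolynomial] using this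

lemma bern_bound (a b c d δ h : ℝ) (f : ℝ → ℝ) (hf : ContinuousOn f (Set.Icc a b))
    (hac : a ≤ c) (hcd : c < d) (hdb : d ≤ b) (q : ℕ) (hq : 1 ≤ q) (hh : d - c ≤ h)
    (hδ : δ = h / Real.sqrt q) (t : ℝ) (ht : t ∈ Set.Icc c d) :
    |f t - bern c d q f t| ≤ 5 / 4 * modCont f a b δ := by
  have hq0 : (0 : ℝ) < q := by exact_mod_cast hq
  have hH : 0 < d - c := sub_pos.2 hcd
  have hh0 : 0 < h := hH.trans_le hh
  have hδ0 : 0 < δ := by rw [hδ]; positivity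
  have hδ2 : δ ^ 2 * q = h ^ 2 := by
    rw [hδ, div_pow, Real.sq_sqrt hq0.le]; field_simp
  have htab : t ∈ Set.Icc a b := ⟨hac.trans ht.1, ht.2.trans hdb⟩
  have hω : 0 ≤ modCont f a b δ :=
    le_csSup (mod_bdd f a b δ hf) ⟨t, t, htab, htab, by simpa using hδ0.le, by simp⟩
  set ω := modCont f a b δ with hωd
  set x := (t - c) / (d - c) with hx
  have hx0 : 0 ≤ x := div_nonneg (sub_nonneg.2 ht.1) hH.le
  have hx1 : 0 ≤ 1 - x := by
    rw [hx, sub_nonneg, div_le_one hH]; linarith [ht.2]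
  have hx2 : (d - t) / (d - c) = 1 - x := by rw [hx]; field_simp; ring
  have htx : t = c + x * (d - c) := by rw [hx]; field_simp; ring
  set w : ℕ → ℝ := fun j => (q.choose j : ℝ) * x ^ j * (1 - x) ^ (q - j) with hw
  have hw0 : ∀ j, 0 ≤ w j := fun j => by simp only [hw]; positivity
  have hs1 : ∑ j ∈ Finset.range (q + 1), w j = 1 := bern_w_sum q x
  have hs2 : ∑ j ∈ Finset.range (q + 1), (q * x - j) ^ 2 * w j = q * x * (1 - x) := bern_w_var q x
  have key : f t - bern c d q f t =
      ∑ j ∈ Finset.range (q + 1), (f t - f (c + (j : ℝ) * (d - c) / q)) * w j := by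
    simp_rw [sub_mul]
    rw [Finset.sum_sub_distrib, ← Finset.mul_sum, hs1, mul_one, bern, ← hx, hx2]
    congr 1
    refine Finset.sum_congr rfl fun j _ => ?_
    simp only [hw]; ring
  set K : ℝ := (d - c) ^ 2 / (q ^ 2 * δ ^ 2) with hK
  rw [key]
  calc _ ≤ ∑ j ∈ Finset.range (q + 1), |(f t - f (c + (j : ℝ) * (d - c) / q)) * w j| :=
        Finset.abs_sum_le_sum_abs _ _
    _ ≤ ∑ j ∈ Finset.range (q + 1), (ω * w j + ω * K * ((q * x - j) ^ 2 * w j)) := by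
        refine Finset.sum_le_sum fun j hj => ?_
        rw [abs_mul, abs_of_nonneg (hw0 j)]
        have hj' : (j : ℝ) ≤ q := by
          exact_mod_cast Nat.lt_succ_iff.1 (Finset.mem_range.1 hj)
        have hm : c + (j : ℝ) * (d - c) / q ∈ Set.Icc a b := by
          have h1 : 0 ≤ (j : ℝ) * (d - c) / q := by positivity
          have h2 : (j : ℝ) * (d - c) / q ≤ d - c := by
            rw [div_le_iff₀ hq0]; nlinarith
          constructor <;> linarith
        have := mul_le_mul_of_nonneg_right (quad_bound f a b δ hδ0 hf _ t hm htab hω) (hw0 j)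
        refine this.trans (le_of_eq ?_)
        have e : ((t - (c + (j : ℝ) * (d - c) / q)) / δ) ^ 2 = K * (q * x - j) ^ 2 := by
          rw [hK]; nth_rw 1 [htx]; field_simp; ring
        rw [e]; ring
    _ = ω + ω * (K * (q * x * (1 - x))) := by
        rw [Finset.sum_add_distrib, ← Finset.mul_sum, ← Finset.mul_sum, hs1, hs2]; ring
    _ ≤ 5 / 4 * ω := by
        have hKq : K * q ≤ 1 := by
          rw [hK, div_mul_eq_mul_div, div_le_one (by positivity)]
          have : (d - c) ^ 2 ≤ h ^ 2 := by gcongr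
          nlinarith
        have hxx : x * (1 - x) ≤ 1 / 4 := by nlinarith [sq_nonneg (x - 1 / 2)]
        have hxx0 : 0 ≤ x * (1 - x) := by positivity
        have : K * (q * x * (1 - x)) ≤ 1 / 4 := by
          have : K * (q * x * (1 - x)) = (K * q) * (x * (1 - x)) := by ring
          rw [this]
          nlinarith
        nlinarith

/-- Bernstein splines error bound. -/
theorem stmt3 (a b : ℝ) (hab : a < b) (f : ℝ → ℝ) (hf : ContinuousOn f (Set.Icc a b))
    (k q : ℕ) (hq : 1 ≤ q) (tk : ℕ → ℝ)
    (h0 : tk 0 = a) (hend : tk (k + 1) = b) (hmono : ∀ i ≤ k, tk i < tk (i + 1))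
    (h : ℝ)
    (hdef : h = (Finset.range (k + 1)).sup'
      (Finset.nonempty_range_iff.mpr (Nat.succ_ne_zero k)) (fun i => tk (i + 1) - tk i))
    (t : ℝ) (ht : t ∈ Set.Icc a b) :
    |f t - spline tk k q f t| ≤ 5 / 4 * modCont f a b (h / Real.sqrt q) := by
  have mono : ∀ n m, n ≤ m → m ≤ k + 1 → tk n ≤ tk m := by
    intro n m hnm
    induction m, hnm using Nat.le_induction with
    | base => intro _; exact le_rfl
    | succ m _ ih => intro hm; exact (ih (by omega)).trans (hmono m (by omega)).le
  classical
  set i := Nat.findGreatest (fun j => tk j ≤ t) k with hi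
  have hik : i ≤ k := Nat.findGreatest_le k
  have hti : tk i ≤ t :=
    Nat.findGreatest_spec (P := fun j => tk j ≤ t) (Nat.zero_le k) (by rw [h0]; exact ht.1)
  have hgt : ∀ j, i < j → j ≤ k → t < tk j := fun j h1 h2 =>
    not_le.1 (Nat.findGreatest_is_greatest (P := fun j => tk j ≤ t) h1 h2)
  have hti1 : t ≤ tk (i + 1) := by
    rcases hik.lt_or_eq with h1 | h1
    · exact (hgt (i + 1) (by omega) (by omega)).le
    · rw [h1, hend]; exact ht.2
  have hsp : spline tk k q f t = bern (tk i) (tk (i + 1)) q f t := by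
    unfold spline
    rw [Finset.sum_eq_single i]
    · apply Set.indicator_of_mem
      unfold knotSet
      split_ifs with h1
      · exact ⟨hti, hgt (i + 1) (by omega) (by omega)⟩
      · exact ⟨hti, hti1⟩
    · intro j hj hji
      have hjk : j ≤ k := Nat.lt_succ_iff.1 (Finset.mem_range.1 hj)
      apply Set.indicator_of_notMem
      intro hmem
      rcases lt_or_gt_of_ne hji with h1 | h1
      · rw [knotSet, if_pos (by omega)] at hmem
        have := mono (j + 1) i (by omega) (by omega)
        linarith [hmem.2]
      · have h2 := hgt j h1 hjk
        have h3 : tk j ≤ t := by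
          unfold knotSet at hmem
          split_ifs at hmem <;> exact hmem.1
        linarith
    · intro hn
      exact absurd (Finset.mem_range.2 (by omega)) hn
  rw [hsp]
  refine bern_bound a b (tk i) (tk (i + 1)) _ h f hf ?_ (hmono i hik) ?_ q hq ?_ rfl t ⟨hti, hti1⟩
  · rw [← h0]; exact mono 0 i (by omega) (by omega)
  · rw [← hend]; exact mono (i + 1) (k + 1) (by omega) le_rfl
  · rw [hdef]
    exact Finset.le_sup' (fun i => tk (i + 1) - tk i) (Finset.mem_range.2 (by omega))
end

section
/- Let 0 < α < 1, let u : [a,b] → ℝ be continuous, let A be a knot collection of size k+1 on [a,b] with maximum knot size h = max_{0≤i≤k} (t_{i+1} − t_i), and let q ∈ ℕ, q ≥ 1. Then sup_{t∈[a,b]} |(I_a^α u)(t) − (S^q_A (I_a^α u))(t)| ≤ (h/√q)^α · (5 ‖u‖_{C[a,b]}) / (2 Γ(α+1)). -/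
/-- Riemann–Liouville fractional integral `(I_a^α f)(t)`. -/
noncomputable def rlInt (a α : ℝ) (f : ℝ → ℝ) (t : ℝ) : ℝ :=
  (1 / Real.Gamma α) * ∫ s in a..t, (t - s) ^ (α - 1) * f s

/-- Sup norm `‖f‖_{C[a,b]} = sup_{t ∈ [a,b]} |f(t)|`. -/
noncomputable def supNorm (f : ℝ → ℝ) (a b : ℝ) : ℝ :=
  sSup ((fun t => |f t|) '' Set.Icc a b)

open intervalIntegral MeasureTheory in
lemma aux_int (α c d t : ℝ) (hα0 : 0 < α) :
    IntervalIntegrable (fun r => (t - r) ^ (α - 1)) volume c d ∧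
    ∫ r in c..d, (t - r) ^ (α - 1) = ((t - c) ^ α - (t - d) ^ α) / α := by
  constructor
  · have := (intervalIntegrable_rpow' (a := t - c) (b := t - d) (r := α - 1) (by linarith)).comp_sub_left t
    simpa using this
  · rw [intervalIntegral.integral_comp_sub_left (fun x => x ^ (α - 1)) t,
      integral_rpow (Or.inl (by linarith))]
    simp

open intervalIntegral MeasureTheory in
lemma aux_holder (α a b M : ℝ) (hα0 : 0 < α) (hα1 : α < 1)
    (u : ℝ → ℝ) (hu : ContinuousOn u (Set.Icc a b)) (hM : ∀ x ∈ Set.Icc a b, |u x| ≤ M)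
    (s t : ℝ) (has : a ≤ s) (hst : s ≤ t) (htb : t ≤ b) :
    |rlInt a α u t - rlInt a α u s| ≤ 2 * M / Real.Gamma (α + 1) * (t - s) ^ α := by
  have hM0 : 0 ≤ M := (abs_nonneg _).trans (hM a ⟨le_rfl, by linarith⟩)
  have hG := Real.Gamma_pos_of_pos hα0
  have hint : ∀ c d x, c ∈ Set.Icc a b → d ∈ Set.Icc a b →
      IntervalIntegrable (fun r => (x - r) ^ (α - 1) * u r) volume c d := by
    intro c d x hc hd
    exact (aux_int α c d x hα0).1.mul_continuousOn (hu.mono (Set.uIcc_subset_Icc hc hd))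
  have ha : a ∈ Set.Icc a b := ⟨le_rfl, by linarith⟩
  have hs : s ∈ Set.Icc a b := ⟨has, by linarith⟩
  have ht : t ∈ Set.Icc a b := ⟨by linarith, htb⟩
  have e1 := integral_add_adjacent_intervals (hint a s t ha hs) (hint s t t hs ht)
  have e2 := intervalIntegral.integral_sub (hint a s t ha hs) (hint a s s ha hs)
  have b1 : |∫ r in s..t, (t - r) ^ (α - 1) * u r| ≤ ∫ r in s..t, (t - r) ^ (α - 1) * M := by
    rw [← Real.norm_eq_abs]
    apply norm_integral_le_of_norm_le hst
    · refine Filter.Eventually.of_forall fun r hr => ?_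
      have : 0 ≤ (t - r) ^ (α - 1) := Real.rpow_nonneg (by linarith [hr.2]) _
      rw [norm_mul, Real.norm_of_nonneg this, Real.norm_eq_abs]
      exact mul_le_mul_of_nonneg_left (hM r ⟨by linarith [hr.1], by linarith [hr.2]⟩) this
    · exact (aux_int α s t t hα0).1.mul_const M
  have b2 : |∫ r in a..s, ((t - r) ^ (α - 1) * u r - (s - r) ^ (α - 1) * u r)| ≤
      ∫ r in a..s, ((s - r) ^ (α - 1) - (t - r) ^ (α - 1)) * M := by
    rw [← Real.norm_eq_abs]
    apply norm_integral_le_of_norm_le has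
    · have hne : ∀ᵐ r : ℝ, r ≠ s := Measure.ae_ne volume s
      filter_upwards [hne] with r hne hr
      have hrs : r < s := lt_of_le_of_ne hr.2 hne
      have : (t - r) ^ (α - 1) ≤ (s - r) ^ (α - 1) :=
        Real.rpow_le_rpow_of_nonpos (by linarith) (by linarith) (by linarith)
      rw [← sub_mul, norm_mul, Real.norm_eq_abs, Real.norm_eq_abs, abs_sub_comm,
        abs_of_nonneg (sub_nonneg.2 this)]
      exact mul_le_mul_of_nonneg_left (hM r ⟨by linarith [hr.1], by linarith [hr.2]⟩)
        (sub_nonneg.2 this)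
    · exact ((aux_int α a s s hα0).1.sub (aux_int α a s t hα0).1).mul_const M
  rw [intervalIntegral.integral_mul_const, (aux_int α s t t hα0).2] at b1
  rw [intervalIntegral.integral_mul_const, intervalIntegral.integral_sub (aux_int α a s s hα0).1 (aux_int α a s t hα0).1,
    (aux_int α a s s hα0).2, (aux_int α a s t hα0).2, e2] at b2
  have hmon : (s - a) ^ α ≤ (t - a) ^ α := Real.rpow_le_rpow (by linarith) (by linarith) hα0.le
  simp only [sub_self, Real.zero_rpow hα0.ne', sub_zero] at b1 b2
  unfold rlInt
  rw [← mul_sub, abs_mul, abs_of_pos (by positivity), Real.Gamma_add_one hα0.ne']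
  set X := ∫ r in a..t, (t - r) ^ (α - 1) * u r
  set Y := ∫ r in a..s, (s - r) ^ (α - 1) * u r
  have key : |X - Y| ≤ 2 * M * (t - s) ^ α / α := by
    rw [← e1, add_sub_right_comm]
    refine (abs_add_le _ _).trans ((add_le_add b2 b1).trans ?_)
    rw [le_div_iff₀ hα0]
    field_simp
    nlinarith
  calc 1 / Real.Gamma α * |X - Y| ≤ 1 / Real.Gamma α * (2 * M * (t - s) ^ α / α) := by gcongr
    _ = _ := by field_simp

lemma aux_pow (α x δ : ℝ) (hα0 : 0 < α) (hα1 : α < 1) (hδ : 0 < δ) (hx : 0 ≤ x) :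
    x ^ α ≤ δ ^ α * (1 + x ^ 2 / δ ^ 2) := by
  have h1 : x = δ * (x / δ) := by field_simp
  have hy : 0 ≤ x / δ := by positivity
  rw [← div_pow]
  set y := x / δ
  rw [h1, Real.mul_rpow hδ.le hy]
  gcongr
  rcases le_total y 1 with h | h
  · have := Real.rpow_le_one hy h hα0.le
    nlinarith [sq_nonneg y]
  · have : y ^ α ≤ y ^ (2:ℝ) := Real.rpow_le_rpow_of_exponent_le h (by linarith)
    rw [Real.rpow_two] at this
    linarith

/-- The Bernstein error bound on one interval for a Hölder function. -/
lemma aux_bern (α c d h H : ℝ) (hα0 : 0 < α) (hα1 : α < 1) (hcd : c < d) (hh : d - c ≤ h)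
    (hH : 0 ≤ H) (q : ℕ) (hq : 1 ≤ q) (f : ℝ → ℝ)
    (hf : ∀ x ∈ Set.Icc c d, ∀ y ∈ Set.Icc c d, |f x - f y| ≤ H * |x - y| ^ α)
    (t : ℝ) (ht : t ∈ Set.Icc c d) :
    |f t - bern c d q f t| ≤ (5 / 4) * H * (h / Real.sqrt q) ^ α := by
  have hdc : 0 < d - c := by linarith
  have hq0 : (0:ℝ) < q := by exact_mod_cast hq
  have hsq : 0 < Real.sqrt q := Real.sqrt_pos.2 hq0
  have hh0 : 0 < h := by linarith
  set δ := h / Real.sqrt q with hδ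
  have hδ0 : 0 < δ := by positivity
  have hδ2 : δ ^ 2 = h ^ 2 / q := by rw [hδ, div_pow, Real.sq_sqrt hq0.le]
  obtain ⟨x, hx⟩ : ∃ x : unitInterval, (x : ℝ) = (t - c) / (d - c) :=
    ⟨⟨(t - c) / (d - c), div_nonneg (by linarith [ht.1]) hdc.le,
      (div_le_one hdc).2 (by linarith [ht.2])⟩, rfl⟩
  have htx : t = c + x * (d - c) := by rw [hx]; field_simp; ring
  have hp := bernstein.probability q x
  have hv := bernstein.variance (n := q) (by omega) x
  have hnn : ∀ j : Fin (q + 1), 0 ≤ bernstein q j x := fun j => bernstein_nonneg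
  have hbern : bern c d q f t =
      ∑ j : Fin (q + 1), f (c + (j : ℝ) * (d - c) / q) * bernstein q j x := by
    unfold bern
    rw [Finset.sum_range]
    refine Finset.sum_congr rfl fun j _ => ?_
    have : (d - t) / (d - c) = 1 - x := by rw [hx]; field_simp; ring
    rw [bernstein_apply, this, ← hx]
    ring
  have hsub : f t - bern c d q f t =
      ∑ j : Fin (q + 1), (f t - f (c + (j : ℝ) * (d - c) / q)) * bernstein q j x := by
    simp only [sub_mul, Finset.sum_sub_distrib, ← Finset.mul_sum, hp]
    rw [hbern, mul_one]
  have hterm : ∀ j : Fin (q + 1), |f t - f (c + (j : ℝ) * (d - c) / q)| ≤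
      H * (δ ^ α * (1 + (q : ℝ) * ((x : ℝ) - (j : ℝ) / q) ^ 2)) := by
    intro j
    have hj : (j : ℝ) ≤ q := by exact_mod_cast Nat.lt_succ_iff.1 j.2
    have hj1 : (j : ℝ) / q ≤ 1 := (div_le_one hq0).2 hj
    have hj0 : 0 ≤ (j : ℝ) / q := by positivity
    have e : c + (j : ℝ) * (d - c) / q = c + (j : ℝ) / q * (d - c) := by ring
    refine (hf t ht _ ⟨?_, ?_⟩).trans ?_
    · rw [e]; nlinarith
    · rw [e]; nlinarith
    · gcongr
      refine (aux_pow α _ δ hα0 hα1 hδ0 (abs_nonneg _)).trans ?_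
      gcongr
      rw [sq_abs, hδ2, e, htx, div_le_iff₀ (by positivity)]
      have : (c + (x:ℝ) * (d - c) - (c + (j : ℝ) / q * (d - c))) ^ 2 =
        ((x : ℝ) - (j : ℝ) / q) ^ 2 * (d - c) ^ 2 := by ring
      rw [this]
      have h2 : (d - c) ^ 2 ≤ h ^ 2 := by gcongr
      have h3 : (q : ℝ) * ((x : ℝ) - (j : ℝ) / q) ^ 2 * (h ^ 2 / q) =
        ((x : ℝ) - (j : ℝ) / q) ^ 2 * h ^ 2 := by field_simp
      rw [h3]
      gcongr
  have hv' : ∑ j : Fin (q + 1), ((x : ℝ) - (j : ℝ) / q) ^ 2 * bernstein q j x =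
      x * (1 - x) / q := by
    simpa [bernstein.z] using hv
  rw [hsub]
  calc _ ≤ ∑ j : Fin (q + 1), |(f t - f (c + (j : ℝ) * (d - c) / q)) * bernstein q j x| :=
        Finset.abs_sum_le_sum_abs _ _
    _ ≤ ∑ j : Fin (q + 1), H * (δ ^ α * (1 + (q : ℝ) * ((x : ℝ) - (j : ℝ) / q) ^ 2)) *
          bernstein q j x := by
        refine Finset.sum_le_sum fun j _ => ?_
        rw [abs_mul, abs_of_nonneg (hnn j)]
        exact mul_le_mul_of_nonneg_right (hterm j) (hnn j)
    _ = H * δ ^ α * (∑ j : Fin (q + 1), bernstein q j x +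
          q * ∑ j : Fin (q + 1), ((x : ℝ) - (j : ℝ) / q) ^ 2 * bernstein q j x) := by
        rw [Finset.mul_sum, ← Finset.sum_add_distrib, Finset.mul_sum]
        refine Finset.sum_congr rfl fun j _ => by ring
    _ = H * δ ^ α * (1 + x * (1 - x)) := by
        rw [hp, hv']; field_simp
    _ ≤ H * δ ^ α * (5 / 4) := by
        gcongr
        nlinarith [sq_nonneg ((x : ℝ) - 1 / 2)]
    _ = _ := by ring

lemma aux_mono (tk : ℕ → ℝ) (k : ℕ) (hmono : ∀ i ≤ k, tk i < tk (i + 1)) (i j : ℕ)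
    (hij : i ≤ j) (hj : j ≤ k + 1) : tk i ≤ tk j := by
  induction j, hij using Nat.le_induction with
  | base => exact le_rfl
  | succ n hn ih => exact (ih (by omega)).trans (hmono n (by omega)).le

lemma aux_spline (tk : ℕ → ℝ) (k q : ℕ) (hmono : ∀ i ≤ k, tk i < tk (i + 1)) (f : ℝ → ℝ)
    (t : ℝ) (h0 : tk 0 ≤ t) (h1 : t ≤ tk (k + 1)) :
    ∃ i ≤ k, t ∈ Set.Icc (tk i) (tk (i + 1)) ∧
      spline tk k q f t = bern (tk i) (tk (i + 1)) q f t := by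
  classical
  set i := Nat.findGreatest (fun i => tk i ≤ t) k with hi
  have hik : i ≤ k := Nat.findGreatest_le k
  have hit : tk i ≤ t := Nat.findGreatest_spec (P := fun i => tk i ≤ t) (Nat.zero_le k) h0
  have hlt : i < k → t < tk (i + 1) := fun hl =>
    not_le.1 (Nat.findGreatest_is_greatest (P := fun i => tk i ≤ t) (Nat.lt_succ_self i) hl)
  have hle : t ≤ tk (i + 1) := by
    rcases hik.lt_or_eq with hl | hl
    · exact (hlt hl).le
    · rw [hl]; exact h1
  refine ⟨i, hik, ⟨hit, hle⟩, ?_⟩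
  unfold spline
  rw [Finset.sum_eq_single i]
  · apply Set.indicator_of_mem
    unfold knotSet
    split_ifs with hl
    · exact ⟨hit, hlt hl⟩
    · exact ⟨hit, hle⟩
  · intro j hj hji
    have hj' : j ≤ k := Nat.lt_succ_iff.1 (Finset.mem_range.1 hj)
    apply Set.indicator_of_notMem
    intro hmem
    rcases lt_or_gt_of_ne hji with hl | hl
    · rw [knotSet, if_pos (by omega)] at hmem
      have := aux_mono tk k hmono (j + 1) i hl (by omega)
      linarith [hmem.2]
    · have h2 : tk j ≤ t := by
        unfold knotSet at hmem
        split_ifs at hmem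
        · exact hmem.1
        · exact hmem.1
      have := aux_mono tk k hmono (i + 1) j hl (by omega)
      linarith [hlt (by omega)]
  · intro hn
    exact absurd (Finset.mem_range.2 (by omega)) hn

/-- Error bound for the spline fractional integration operator. -/
theorem stmt4 (α a b : ℝ) (hα0 : 0 < α) (hα1 : α < 1) (hab : a < b)
    (u : ℝ → ℝ) (hu : ContinuousOn u (Set.Icc a b))
    (k q : ℕ) (hq : 1 ≤ q) (tk : ℕ → ℝ)
    (h0 : tk 0 = a) (hend : tk (k + 1) = b) (hmono : ∀ i ≤ k, tk i < tk (i + 1))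
    (h : ℝ)
    (hdef : h = (Finset.range (k + 1)).sup'
      (Finset.nonempty_range_iff.mpr (Nat.succ_ne_zero k)) (fun i => tk (i + 1) - tk i)) :
    sSup ((fun t => |rlInt a α u t - spline tk k q (rlInt a α u) t|) '' Set.Icc a b) ≤
      (h / Real.sqrt q) ^ α * (5 * supNorm u a b / (2 * Real.Gamma (α + 1))) := by
  have hbdd : BddAbove ((fun t => |u t|) '' Set.Icc a b) :=
    (isCompact_Icc.image_of_continuousOn hu.abs).bddAbove
  have hM : ∀ x ∈ Set.Icc a b, |u x| ≤ supNorm u a b := fun x hx =>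
    le_csSup hbdd ⟨x, hx, rfl⟩
  have hM0 : 0 ≤ supNorm u a b := (abs_nonneg _).trans (hM a ⟨le_rfl, hab.le⟩)
  have hG := Real.Gamma_pos_of_pos (show 0 < α + 1 by linarith)
  apply csSup_le ((Set.nonempty_Icc.2 hab.le).image _)
  rintro _ ⟨t, ht, rfl⟩
  obtain ⟨i, hik, hti, hs⟩ := aux_spline tk k q hmono (rlInt a α u) t
    (by rw [h0]; exact ht.1) (by rw [hend]; exact ht.2)
  have hai : a ≤ tk i := h0 ▸ aux_mono tk k hmono 0 i (Nat.zero_le _) (by omega)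
  have hib : tk (i + 1) ≤ b := hend ▸ aux_mono tk k hmono (i + 1) (k + 1) (by omega) le_rfl
  have hh : tk (i + 1) - tk i ≤ h := by
    rw [hdef]
    exact Finset.le_sup' (fun i => tk (i + 1) - tk i) (Finset.mem_range.2 (by omega))
  have key := aux_bern α (tk i) (tk (i + 1)) h (2 * supNorm u a b / Real.Gamma (α + 1)) hα0 hα1
    (hmono i hik) hh (by positivity) q hq (rlInt a α u) (by
      intro x hx y hy
      rcases le_total x y with hxy | hxy
      · rw [abs_sub_comm, abs_sub_comm x y, abs_of_nonneg (sub_nonneg.2 hxy)]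
        exact aux_holder α a b _ hα0 hα1 u hu hM x y (hai.trans hx.1) hxy (hy.2.trans hib)
      · rw [abs_of_nonneg (sub_nonneg.2 hxy)]
        exact aux_holder α a b _ hα0 hα1 u hu hM y x (hai.trans hy.1) hxy (hx.2.trans hib)) t hti
  simp only [hs]
  refine key.trans (le_of_eq ?_)
  field_simp
  ring
end

section
/- Let 0 < α < 1, 0 < γ ≤ 1, q ∈ ℕ with q ≥ 1, and let 0 < ε ≤ t_i < t_{i+1} with h_i = t_{i+1} − t_i. Let A be a knot collection on [t_i, t_{i+1}] consisting of the single knot [t_i, t_{i+1}], and let f : (0,T] × ℝ → ℝ satisfy the Lipschitz condition |f(t, y_1) − f(t, y_2)| ≤ K |y_1 − y_2| for all t and y_1, y_2, where K ≥ 0. For a continuous function u : [t_i, t_{i+1}] → ℝ set F_u(s) = f(s, s^(γ−1) u(s)), and assume F_{u_1}, F_{u_2} are continuous for continuous u_1, u_2. Then sup_{t∈[t_i,t_{i+1}]} t^(1−γ) |(S^q_A (I_{t_i}^α (F_{u_1} − F_{u_2})))(t)| ≤ (1 + h_i/t_i)^(1−γ) · Ψ_i · K · sup_{s∈[t_i,t_{i+1}]}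 |u_1(s) − u_2(s)|, where Ψ_i = ((5/2)(h_i/√q)^α + h_i^α)/Γ(α+1). -/
lemma rl_bound (a t h α M : ℝ) (hα : 0 < α) (hat : a ≤ t) (hth : t - a ≤ h) (F : ℝ → ℝ)
    (hM : 0 ≤ M) (hF : ∀ s ∈ Set.Icc a t, |F s| ≤ M) :
    |rlInt a α F t| ≤ h ^ α / Real.Gamma (α + 1) * M := by
  have hG : 0 < Real.Gamma α := Real.Gamma_pos_of_pos hα
  have hint : IntervalIntegrable (fun s : ℝ => (t - s) ^ (α - 1)) MeasureTheory.volume a t := by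
    have h0 : IntervalIntegrable (fun s : ℝ => s ^ (α - 1)) MeasureTheory.volume (t - a) (t - t) :=
      intervalIntegral.intervalIntegrable_rpow' (by linarith)
    simpa using h0.comp_sub_left t
  have hval : ∫ s in a..t, (t - s) ^ (α - 1) = (t - a) ^ α / α := by
    rw [intervalIntegral.integral_comp_sub_left (fun s : ℝ => s ^ (α - 1)) t,
      integral_rpow (Or.inl (by linarith))]
    simp [Real.zero_rpow hα.ne']
  have h1 : ‖∫ s in a..t, (t - s) ^ (α - 1) * F s‖ ≤ ∫ s in a..t, (t - s) ^ (α - 1) * M := by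
    apply intervalIntegral.norm_integral_le_of_norm_le hat _ (hint.mul_const M)
    refine Filter.Eventually.of_forall fun s hs => ?_
    have hp : 0 ≤ (t - s) ^ (α - 1) := Real.rpow_nonneg (by linarith [hs.2]) _
    rw [Real.norm_eq_abs, abs_mul, abs_of_nonneg hp]
    exact mul_le_mul_of_nonneg_left (hF s ⟨hs.1.le, hs.2⟩) hp
  rw [intervalIntegral.integral_mul_const, hval, Real.norm_eq_abs] at h1
  have h2 : (t - a) ^ α ≤ h ^ α := Real.rpow_le_rpow (by linarith) hth hα.le
  unfold rlInt
  rw [abs_mul, abs_of_pos (by positivity), Real.Gamma_add_one hα.ne']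
  calc 1 / Real.Gamma α * |∫ s in a..t, (t - s) ^ (α - 1) * F s|
      ≤ 1 / Real.Gamma α * (h ^ α / α * M) := by
        gcongr
        exact h1.trans (by gcongr)
    _ = _ := by field_simp

lemma bern_bound_s7 (a b t C : ℝ) (hab : a < b) (ht : t ∈ Set.Icc a b) (q : ℕ) (hq : 1 ≤ q)
    (g : ℝ → ℝ) (hg : ∀ s ∈ Set.Icc a b, |g s| ≤ C) : |bern a b q g t| ≤ C := by
  have hq' : (0 : ℝ) < q := by exact_mod_cast hq
  have hba : 0 < b - a := by linarith
  have hx : 0 ≤ (t - a) / (b - a) := div_nonneg (by linarith [ht.1]) hba.le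
  have hy : 0 ≤ (b - t) / (b - a) := div_nonneg (by linarith [ht.2]) hba.le
  have hxy : (t - a) / (b - a) + (b - t) / (b - a) = 1 := by field_simp; ring
  have hs := add_pow ((t - a) / (b - a)) ((b - t) / (b - a)) q
  rw [hxy, one_pow] at hs
  unfold bern
  calc _ ≤ ∑ j ∈ Finset.range (q + 1), |_| := Finset.abs_sum_le_sum_abs _ _
    _ ≤ ∑ j ∈ Finset.range (q + 1), C * (((t - a) / (b - a)) ^ j *
          ((b - t) / (b - a)) ^ (q - j) * (q.choose j : ℝ)) := by
        apply Finset.sum_le_sum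
        intro j hj
        have hj' : (j : ℝ) ≤ q := by
          exact_mod_cast Nat.lt_succ_iff.mp (Finset.mem_range.mp hj)
        have hw : 0 ≤ ((t - a) / (b - a)) ^ j * ((b - t) / (b - a)) ^ (q - j) *
          (q.choose j : ℝ) := by positivity
        have hm : a + (j : ℝ) * (b - a) / (q : ℝ) ∈ Set.Icc a b := by
          constructor
          · have : 0 ≤ (j : ℝ) * (b - a) / (q : ℝ) := by positivity
            linarith
          · have : (j : ℝ) * (b - a) / (q : ℝ) ≤ b - a := by
              rw [div_le_iff₀ hq']; nlinarith
            linarith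
        have e : g (a + (j : ℝ) * (b - a) / (q : ℝ)) * (q.choose j : ℝ) *
            ((t - a) / (b - a)) ^ j * ((b - t) / (b - a)) ^ (q - j) =
            g (a + (j : ℝ) * (b - a) / (q : ℝ)) * (((t - a) / (b - a)) ^ j *
              ((b - t) / (b - a)) ^ (q - j) * (q.choose j : ℝ)) := by ring
        rw [e, abs_mul, abs_of_nonneg hw]
        exact mul_le_mul_of_nonneg_right (hg _ hm) hw
    _ = C := by rw [← Finset.mul_sum, ← hs, mul_one]

/-- Contraction estimate for one Picard iteration on a single knot `[t_i, t_{i+1}]`. -/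
theorem stmt7 (α γ : ℝ) (hα0 : 0 < α) (hα1 : α < 1) (hγ0 : 0 < γ) (hγ1 : γ ≤ 1)
    (q : ℕ) (hq : 1 ≤ q) (ε ti ti1 : ℝ) (hε : 0 < ε) (hεti : ε ≤ ti) (hti : ti < ti1)
    (hi : ℝ) (hhi : hi = ti1 - ti)
    (K : ℝ) (hK : 0 ≤ K)
    (f : ℝ → ℝ → ℝ)
    (hLip : ∀ t y₁ y₂, |f t y₁ - f t y₂| ≤ K * |y₁ - y₂|)
    (u₁ u₂ : ℝ → ℝ)
    (hu₁ : ContinuousOn u₁ (Set.Icc ti ti1)) (hu₂ : ContinuousOn u₂ (Set.Icc ti ti1))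
    (hF₁ : ContinuousOn (fun s => f s (s ^ (γ - 1) * u₁ s)) (Set.Icc ti ti1))
    (hF₂ : ContinuousOn (fun s => f s (s ^ (γ - 1) * u₂ s)) (Set.Icc ti ti1)) :
    sSup ((fun t => t ^ (1 - γ) *
        |spline (fun n => if n = 0 then ti else ti1) 0 q
          (rlInt ti α
            (fun s => f s (s ^ (γ - 1) * u₁ s) - f s (s ^ (γ - 1) * u₂ s))) t|) ''
        Set.Icc ti ti1) ≤
      (1 + hi / ti) ^ (1 - γ) *
        ((5 / 2 * (hi / Real.sqrt q) ^ α + hi ^ α) / Real.Gamma (α + 1)) * K *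
        sSup ((fun s => |u₁ s - u₂ s|) '' Set.Icc ti ti1) := by
  have hti0 : 0 < ti := by linarith
  set U := sSup ((fun s => |u₁ s - u₂ s|) '' Set.Icc ti ti1) with hU
  have hbdd : BddAbove ((fun s => |u₁ s - u₂ s|) '' Set.Icc ti ti1) :=
    (isCompact_Icc.image_of_continuousOn (hu₁.sub hu₂).abs).bddAbove
  have hle : ∀ s ∈ Set.Icc ti ti1, |u₁ s - u₂ s| ≤ U := fun s hs =>
    le_csSup hbdd ⟨s, hs, rfl⟩
  have hU0 : 0 ≤ U := (abs_nonneg _).trans (hle ti ⟨le_rfl, hti.le⟩)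
  have hhi0 : 0 < hi := by linarith
  have hG : 0 < Real.Gamma (α + 1) := Real.Gamma_pos_of_pos (by linarith)
  have hM : 0 ≤ K * (ti ^ (γ - 1) * U) := by positivity
  have hF : ∀ s ∈ Set.Icc ti ti1,
      |f s (s ^ (γ - 1) * u₁ s) - f s (s ^ (γ - 1) * u₂ s)| ≤ K * (ti ^ (γ - 1) * U) := by
    intro s hs
    refine (hLip _ _ _).trans ?_
    have hp : 0 ≤ s ^ (γ - 1) := Real.rpow_nonneg (by linarith [hs.1]) _
    rw [← mul_sub, abs_mul, abs_of_nonneg hp]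
    have h1 : s ^ (γ - 1) ≤ ti ^ (γ - 1) :=
      Real.rpow_le_rpow_of_nonpos hti0 hs.1 (by linarith)
    have h2 := hle s hs
    gcongr
  apply csSup_le ((Set.nonempty_Icc.mpr hti.le).image _)
  rintro _ ⟨t, ht, rfl⟩
  have hb := bern_bound_s7 ti ti1 t (hi ^ α / Real.Gamma (α + 1) * (K * (ti ^ (γ - 1) * U))) hti ht q hq
    (rlInt ti α (fun s => f s (s ^ (γ - 1) * u₁ s) - f s (s ^ (γ - 1) * u₂ s)))
    (fun s hs => rl_bound ti s hi α _ hα0 hs.1 (by linarith [hs.2]) _ hM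
      (fun r hr => hF r ⟨hr.1, hr.2.trans hs.2⟩))
  have hsp : ∀ g : ℝ → ℝ, spline (fun n => if n = 0 then ti else ti1) 0 q g t =
      bern ti ti1 q g t := by
    intro g
    simp [spline, knotSet, Set.indicator_of_mem ht]
  have ht0 : 0 < t := by linarith [ht.1]
  have hr : t ^ (1 - γ) * ti ^ (γ - 1) ≤ (1 + hi / ti) ^ (1 - γ) := by
    have e : ti ^ (γ - 1) = (ti ^ (1 - γ))⁻¹ := by
      rw [← Real.rpow_neg hti0.le]; congr 1; ring
    rw [e, ← div_eq_mul_inv, ← Real.div_rpow ht0.le hti0.le]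
    apply Real.rpow_le_rpow (by positivity) _ (by linarith)
    rw [div_le_iff₀ hti0, add_mul, div_mul_cancel₀ _ hti0.ne']
    linarith [ht.2]
  have hc : hi ^ α / Real.Gamma (α + 1) ≤
      (5 / 2 * (hi / Real.sqrt q) ^ α + hi ^ α) / Real.Gamma (α + 1) := by
    have : 0 ≤ 5 / 2 * (hi / Real.sqrt q) ^ α := by positivity
    gcongr
    linarith
  show t ^ (1 - γ) * |spline (fun n => if n = 0 then ti else ti1) 0 q _ t| ≤ _
  rw [hsp]
  calc _ ≤ t ^ (1 - γ) * (hi ^ α / Real.Gamma (α + 1) * (K * (ti ^ (γ - 1) * U))) := by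
        gcongr
    _ = (t ^ (1 - γ) * ti ^ (γ - 1)) * (hi ^ α / Real.Gamma (α + 1)) * K * U := by ring
    _ ≤ _ := by gcongr
end

section
/- Let 0 < α < 1, 0 ≤ β ≤ 1, γ = α + β − αβ, 0 < ε < T, q ∈ ℕ with q ≥ 1, and ỹ_0 ∈ ℝ. Let A be a knot collection of size k+1 on [ε, T] with knots ε = t_0 < t_1 < … < t_{k+1} = T and knot sizes h_i = t_{i+1} − t_i. Let f : (0,T] × ℝ → ℝ be such that for every y with t ↦ t^(1−γ) y(t) continuous on [0,T], the map t ↦ t^(1−γ) f(t, y(t)) is continuous on [0,T], and such that |f(t, y_1) − f(t, y_2)| ≤ K |y_1 − y_2| for all t, y_1, y_2, where K ≥ 0. If (1 + h_i/t_i)^(1−γ) · Ψ_i · K < 1 for all i ∈ {0, …, k}, where Ψ_i = ((5/2)(h_i/√q)^α + h_i^α)/Γ(α+1), then there exists a function y : [ε, T] → ℝ with t ↦ t^(1−γ) y(t) continuous on [ε,T] such that y(t) = (ỹ_0/Γ(γ)) t^(γ−1) + (S^q_A (I_ε^α (s ↦ f(s, y(s)))))(t) for all t ∈ [ε, T]. 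-/
/-- Bernstein weights on `[a, b]`. -/
noncomputable def bwt (a b : ℝ) (q j : ℕ) (t : ℝ) : ℝ :=
  (q.choose j : ℝ) * ((t - a) / (b - a)) ^ j * ((b - t) / (b - a)) ^ (q - j)

theorem bern_eq_fin (a b : ℝ) (q : ℕ) (g : ℝ → ℝ) (t : ℝ) :
    bern a b q g t =
      ∑ j : Fin (q + 1), g (a + ((j : ℕ) : ℝ) * (b - a) / (q : ℝ)) * bwt a b q j t := by
  unfold bern bwt
  rw [Finset.sum_range]
  refine Finset.sum_congr rfl fun j _ => ?_
  ring

theorem bwt_nonneg {a b : ℝ} (hab : a < b) (q j : ℕ) {t : ℝ} (ht : t ∈ Set.Icc a b) :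
    0 ≤ bwt a b q j t := by
  have h1 : 0 ≤ t - a := sub_nonneg.2 ht.1
  have h2 : 0 ≤ b - t := sub_nonneg.2 ht.2
  have h3 : 0 ≤ b - a := by linarith
  unfold bwt
  positivity

theorem bwt_sum {a b : ℝ} (hab : a < b) (q : ℕ) (t : ℝ) :
    ∑ j : Fin (q + 1), bwt a b q j t = 1 := by
  have h3 : b - a ≠ 0 := by
    intro h
    linarith
  have h := add_pow ((t - a) / (b - a)) ((b - t) / (b - a)) q
  have h1 : (t - a) / (b - a) + (b - t) / (b - a) = 1 := by
    field_simp
    ring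
  rw [h1, one_pow, Finset.sum_range] at h
  rw [h]
  refine Finset.sum_congr rfl fun j _ => ?_
  unfold bwt
  ring

theorem bwt_cont (a b : ℝ) (q j : ℕ) : Continuous (bwt a b q j) := by
  unfold bwt
  fun_prop

theorem bern_at_left {a b : ℝ} (hab : a < b) {q : ℕ} (g : ℝ → ℝ) :
    bern a b q g a = g a := by
  have h3 : b - a ≠ 0 := by
    intro h
    linarith
  unfold bern
  rw [Finset.sum_eq_single 0]
  · simp [h3]
  · intro j _ hj
    simp [hj]
  · simp

theorem bern_at_right {a b : ℝ} (hab : a < b) {q : ℕ} (hq : 1 ≤ q) (g : ℝ → ℝ) :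
    bern a b q g b = g b := by
  have h3 : b - a ≠ 0 := by
    intro h
    linarith
  have hq' : (q : ℝ) ≠ 0 := by positivity
  unfold bern
  rw [Finset.sum_eq_single q]
  · have : a + (q : ℝ) * (b - a) / q = b := by
      field_simp
      ring
    simp [h3, this]
  · intro j hj hjq
    have : q - j ≠ 0 := by
      have := Finset.mem_range.1 hj
      omega
    simp [this]
  · simp

theorem node_mem {a b : ℝ} (hab : a < b) {q : ℕ} (hq : 1 ≤ q) {j : ℕ} (hj : j ≤ q) :
    a + (j : ℝ) * (b - a) / (q : ℝ) ∈ Set.Icc a b := by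
  have hq' : (0 : ℝ) < q := by positivity
  have h3 : 0 ≤ b - a := by linarith
  have hj' : (j : ℝ) ≤ q := by exact_mod_cast hj
  constructor
  · have : 0 ≤ (j : ℝ) * (b - a) / (q : ℝ) := by positivity
    linarith
  · have : (j : ℝ) * (b - a) / (q : ℝ) ≤ b - a := by
      rw [div_le_iff₀ hq']
      nlinarith
    linarith

theorem bern_congr {a b : ℝ} (hab : a < b) {q : ℕ} (hq : 1 ≤ q) {g g' : ℝ → ℝ}
    (h : ∀ x ∈ Set.Icc a b, g x = g' x) (t : ℝ) : bern a b q g t = bern a b q g' t := by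
  unfold bern
  refine Finset.sum_congr rfl fun j hj => ?_
  have hj := Finset.mem_range.1 hj
  rw [h _ (node_mem hab hq (by omega))]

theorem rlInt_congr {a α t : ℝ} (hat : a ≤ t) {g g' : ℝ → ℝ}
    (h : ∀ s ∈ Set.Icc a t, g s = g' s) : rlInt a α g t = rlInt a α g' t := by
  unfold rlInt
  congr 1
  refine intervalIntegral.integral_congr fun s hs => ?_
  rw [Set.uIcc_of_le hat] at hs
  simp only [h s hs]

theorem kernel_integrable {a b x α : ℝ} (hα0 : 0 < α) (hab : a ≤ b) {g : ℝ → ℝ}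
    (hg : ContinuousOn g (Set.Icc a b)) :
    IntervalIntegrable (fun s => (x - s) ^ (α - 1) * g s) MeasureTheory.volume a b := by
  have h1 : IntervalIntegrable (fun s : ℝ => s ^ (α - 1)) MeasureTheory.volume (x - a) (x - b) :=
    intervalIntegral.intervalIntegrable_rpow' (by linarith)
  have h2 := h1.comp_sub_left x
  simp only [sub_sub_cancel] at h2
  refine h2.mul_continuousOn ?_
  rwa [Set.uIcc_of_le hab]

theorem kernel_integral {a x α : ℝ} (hα0 : 0 < α) :
    ∫ s in a..x, (x - s) ^ (α - 1) = (x - a) ^ α / α := by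
  rw [intervalIntegral.integral_comp_sub_left (fun s : ℝ => s ^ (α - 1)) x]
  rw [integral_rpow (Or.inl (by linarith))]
  simp [hα0.ne']

theorem f_cont {γ T : ℝ} (hγ : γ ≤ 1) (f : ℝ → ℝ → ℝ)
    (hfc : ∀ y : ℝ → ℝ, ContinuousOn (fun t => t ^ (1 - γ) * y t) (Set.Icc 0 T) →
      ContinuousOn (fun t => t ^ (1 - γ) * f t (y t)) (Set.Icc 0 T))
    {a b : ℝ} (ha : 0 < a) (hab : a ≤ b) (hbT : b ≤ T) {y : ℝ → ℝ}
    (hy : ContinuousOn y (Set.Icc a b)) :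
    ContinuousOn (fun t => f t (y t)) (Set.Icc a b) := by
  set z : ℝ → ℝ := Set.IccExtend hab ((Set.Icc a b).domRestrict y) with hz
  have hzc : Continuous z := (continuousOn_iff_continuous_domRestrict.1 hy).Icc_extend'
  have hzy : ∀ t ∈ Set.Icc a b, z t = y t := fun t ht => by
    rw [hz, Set.IccExtend_of_mem hab _ ht]
    rfl
  have h1 := hfc z
    ((Real.continuous_rpow_const (by linarith)).mul hzc).continuousOn
  have h2 : ContinuousOn (fun t => t ^ (1 - γ) * f t (z t)) (Set.Icc a b) :=
    h1.mono (Set.Icc_subset_Icc ha.le hbT)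
  have h3 : ContinuousOn (fun t : ℝ => t ^ (γ - 1)) (Set.Icc a b) := fun t ht =>
    (Real.continuousAt_rpow_const t _ (Or.inl (by linarith [ht.1]))).continuousWithinAt
  refine (h3.mul h2).congr fun t ht => ?_
  have ht0 : 0 < t := lt_of_lt_of_le ha ht.1
  show f t (y t) = t ^ (γ - 1) * (t ^ (1 - γ) * f t (z t))
  rw [hzy t ht, ← mul_assoc, ← Real.rpow_add ht0]
  simp

/-- Extension over one knot interval by the contraction principle. -/
theorem extend_step {α ε b d K : ℝ} (hα0 : 0 < α) (hK : 0 ≤ K) (hεb : ε ≤ b) (hbd : b < d)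
    {q : ℕ} (hq : 1 ≤ q) (f : ℝ → ℝ → ℝ)
    (hf : ∀ a a' : ℝ, ε ≤ a → a ≤ a' → a' ≤ d → ∀ y : ℝ → ℝ, ContinuousOn y (Set.Icc a a') →
      ContinuousOn (fun t => f t (y t)) (Set.Icc a a'))
    (hLip : ∀ t y₁ y₂, |f t y₁ - f t y₂| ≤ K * |y₁ - y₂|)
    (hc : (d - b) ^ α / Real.Gamma (α + 1) * K < 1)
    (C : ℝ → ℝ) (hC : ContinuousOn C (Set.Icc ε d))
    (y : ℝ → ℝ) (hy : ContinuousOn y (Set.Icc ε b))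
    (hyb : y b = C b + rlInt ε α (fun s => f s (y s)) b) :
    ∃ y' : ℝ → ℝ, (∀ t ≤ b, y' t = y t) ∧ ContinuousOn y' (Set.Icc ε d) ∧
      ∀ t ∈ Set.Icc b d, y' t = C t + bern b d q (rlInt ε α (fun s => f s (y' s))) t := by
  have hΓ : 0 < Real.Gamma α := Real.Gamma_pos_of_pos hα0
  have hΓ1 : Real.Gamma (α + 1) = α * Real.Gamma α := Real.Gamma_add_one hα0.ne'
  let x : ℕ → ℝ := fun j => b + (j : ℝ) * (d - b) / (q : ℝ)
  have hx : ∀ j : Fin (q + 1), x j ∈ Set.Icc b d := fun j => node_mem hbd hq (by omega)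
  let p : (Fin (q + 1) → ℝ) → ℝ → ℝ := fun v t => C t + ∑ j : Fin (q + 1), v j * bwt b d q j t
  have hpc : ∀ v, ContinuousOn (p v) (Set.Icc b d) := fun v => by
    refine (hC.mono (Set.Icc_subset_Icc_left hεb)).add (Continuous.continuousOn ?_)
    exact continuous_finsetSum _ fun j _ => continuous_const.mul (bwt_cont _ _ _ _)
  have hfp : ∀ v, ContinuousOn (fun s => f s (p v s)) (Set.Icc b d) := fun v =>
    hf b d hεb hbd.le le_rfl _ (hpc v)
  let Φ : (Fin (q + 1) → ℝ) → (Fin (q + 1) → ℝ) := fun v j =>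
    (1 / Real.Gamma α) * ((∫ s in ε..b, (x j - s) ^ (α - 1) * f s (y s)) +
      ∫ s in b..x j, (x j - s) ^ (α - 1) * f s (p v s))
  have hpdiff : ∀ v w, ∀ t ∈ Set.Icc b d, |p v t - p w t| ≤ dist v w := by
    intro v w t ht
    have : p v t - p w t = ∑ j : Fin (q + 1), (v j - w j) * bwt b d q j t := by
      simp only [p, sub_mul, Finset.sum_sub_distrib]
      ring
    rw [this]
    calc |∑ j : Fin (q + 1), (v j - w j) * bwt b d q j t|
        ≤ ∑ j : Fin (q + 1), |(v j - w j) * bwt b d q j t| := Finset.abs_sum_le_sum_abs _ _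
      _ ≤ ∑ j : Fin (q + 1), dist v w * bwt b d q j t := by
          refine Finset.sum_le_sum fun j _ => ?_
          have h0 := bwt_nonneg hbd q j ht
          rw [abs_mul, abs_of_nonneg h0]
          refine mul_le_mul_of_nonneg_right ?_ h0
          rw [← Real.dist_eq]
          exact dist_le_pi_dist v w j
      _ = dist v w := by rw [← Finset.mul_sum, bwt_sum hbd, mul_one]
  set L : ℝ := (d - b) ^ α / Real.Gamma (α + 1) * K with hL
  have hdb : 0 ≤ d - b := by linarith
  have hL0 : 0 ≤ L := by
    rw [hL, hΓ1]
    positivity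
  have hΦ : ContractingWith ⟨L, hL0⟩ Φ := by
    refine ⟨by exact_mod_cast hc, LipschitzWith.of_dist_le_mul fun v w => ?_⟩
    show dist (Φ v) (Φ w) ≤ L * dist v w
    rw [dist_pi_le_iff (by positivity)]
    intro j
    have hxj := hx j
    have hsub : Set.Icc b (x j) ⊆ Set.Icc b d := Set.Icc_subset_Icc_right hxj.2
    have hiv := fun v => kernel_integrable (x := x j) hα0 hxj.1 ((hfp v).mono hsub)
    have hi1 := kernel_integrable (x := x j) (g := fun _ => K * dist v w) hα0 hxj.1
      continuousOn_const
    have e1 : Φ v j - Φ w j = (1 / Real.Gamma α) *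
        ∫ s in b..x j, ((x j - s) ^ (α - 1) * f s (p v s) - (x j - s) ^ (α - 1) * f s (p w s)) := by
      rw [intervalIntegral.integral_sub (hiv v) (hiv w)]
      simp only [Φ]
      ring
    have e2 : |∫ s in b..x j, ((x j - s) ^ (α - 1) * f s (p v s)
          - (x j - s) ^ (α - 1) * f s (p w s))|
        ≤ ∫ s in b..x j, (x j - s) ^ (α - 1) * (K * dist v w) := by
      rw [← Real.norm_eq_abs]
      refine intervalIntegral.norm_integral_le_of_norm_le hxj.1 ?_ hi1
      refine Filter.Eventually.of_forall fun s hs => ?_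
      have hs0 : 0 ≤ x j - s := sub_nonneg.2 hs.2
      rw [← mul_sub, Real.norm_eq_abs, abs_mul, abs_of_nonneg (Real.rpow_nonneg hs0 _)]
      refine mul_le_mul_of_nonneg_left ?_ (Real.rpow_nonneg hs0 _)
      refine (hLip _ _ _).trans (mul_le_mul_of_nonneg_left ?_ hK)
      exact hpdiff v w s ⟨hs.1.le, hs.2.trans hxj.2⟩
    rw [intervalIntegral.integral_mul_const, kernel_integral hα0] at e2
    have e3 : (x j - b) ^ α ≤ (d - b) ^ α :=
      Real.rpow_le_rpow (sub_nonneg.2 hxj.1) (by linarith [hxj.2]) hα0.le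
    rw [Real.dist_eq, e1, abs_mul, abs_of_pos (by positivity : 0 < 1 / Real.Gamma α)]
    calc 1 / Real.Gamma α * _ ≤ 1 / Real.Gamma α * ((x j - b) ^ α / α * (K * dist v w)) := by
          gcongr
      _ ≤ 1 / Real.Gamma α * ((d - b) ^ α / α * (K * dist v w)) := by gcongr
      _ = L * dist v w := by
          rw [hL, hΓ1]
          field_simp
  obtain ⟨v, hv⟩ : ∃ v, Φ v = v := ⟨_, hΦ.fixedPoint_isFixedPt⟩
  have hx0 : x 0 = b := by simp [x]
  have hpb : p v b = y b := by
    have h0 : v 0 = rlInt ε α (fun s => f s (y s)) b := by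
      rw [← congrFun hv 0]
      simp only [Φ, rlInt, Fin.val_zero, hx0, intervalIntegral.integral_same, add_zero]
    rw [hyb, ← h0]
    simp only [p]
    congr 1
    rw [Finset.sum_eq_single 0]
    · have : d - b ≠ 0 := by
        intro h
        linarith
      simp [bwt, this]
    · intro j _ hj
      have : (j : ℕ) ≠ 0 := fun h => hj (Fin.ext h)
      simp [bwt, this]
    · simp
  let y' : ℝ → ℝ := fun t => if t ≤ b then y t else p v t
  have hy'1 : ∀ t ≤ b, y' t = y t := fun t ht => if_pos ht
  have hy'2 : ∀ t, b ≤ t → y' t = p v t := fun t ht => by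
    rcases ht.eq_or_lt with rfl | h
    · rw [hy'1 _ le_rfl, hpb]
    · exact if_neg (not_le.2 h)
  have hy'c : ContinuousOn y' (Set.Icc ε d) := by
    rw [← Set.Icc_union_Icc_eq_Icc hεb hbd.le]
    refine ContinuousOn.union_of_isClosed ?_ ?_ isClosed_Icc isClosed_Icc
    · exact hy.congr fun t ht => hy'1 t ht.2
    · exact (hpc v).congr fun t ht => hy'2 t ht.1
  refine ⟨y', hy'1, hy'c, fun t ht => ?_⟩
  rw [hy'2 t ht.1, bern_eq_fin]
  simp only [p]
  congr 1
  refine Finset.sum_congr rfl fun j _ => ?_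
  congr 1
  rw [← congrFun hv j]
  have hxj := hx j
  show Φ v j = rlInt ε α (fun s => f s (y' s)) (x j)
  have hfy' := hf ε d le_rfl (hεb.trans hbd.le) le_rfl y' hy'c
  unfold rlInt
  rw [← intervalIntegral.integral_add_adjacent_intervals
    (kernel_integrable hα0 hεb (hfy'.mono (Set.Icc_subset_Icc_right hbd.le)))
    (kernel_integrable hα0 hxj.1 (hfy'.mono (Set.Icc_subset_Icc hεb hxj.2)))]
  simp only [Φ]
  congr 2
  · refine intervalIntegral.integral_congr fun s hs => ?_
    rw [Set.uIcc_of_le hεb] at hs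
    simp only [hy'1 s hs.2]
  · refine intervalIntegral.integral_congr fun s hs => ?_
    rw [Set.uIcc_of_le hxj.1] at hs
    simp only [hy'2 s hs.1]

theorem knots_le {tk : ℕ → ℝ} {k : ℕ} (hmono : ∀ i ≤ k, tk i < tk (i + 1)) {i j : ℕ}
    (hij : i ≤ j) (hj : j ≤ k + 1) : tk i ≤ tk j := by
  induction j, hij using Nat.le_induction with
  | base => exact le_rfl
  | succ n hn ih => exact (ih (by omega)).trans (hmono n (by omega)).le

theorem spline_eq {tk : ℕ → ℝ} {k : ℕ} (hmono : ∀ i ≤ k, tk i < tk (i + 1)) (q : ℕ)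
    (g : ℝ → ℝ) {t : ℝ} (ht : t ∈ Set.Icc (tk 0) (tk (k + 1))) :
    ∃ i ≤ k, t ∈ Set.Icc (tk i) (tk (i + 1)) ∧
      spline tk k q g t = bern (tk i) (tk (i + 1)) q g t := by
  have hex : ∃ i, i ≤ k ∧ t ∈ knotSet tk k i := by
    by_contra! hne
    have hall : ∀ i ≤ k, tk i ≤ t := by
      intro i
      induction i with
      | zero => exact fun _ => ht.1
      | succ n ih =>
        intro hn
        have h1 := hne n (by omega)
        rw [knotSet, if_pos (by omega)] at h1
        by_contra hlt
        exact h1 ⟨ih (by omega), not_le.1 hlt⟩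
    have h1 := hne k le_rfl
    rw [knotSet, if_neg (by omega)] at h1
    exact h1 ⟨hall k le_rfl, ht.2⟩
  obtain ⟨i, hik, hi⟩ := hex
  have hsub : ∀ j, t ∈ knotSet tk k j → t ∈ Set.Icc (tk j) (tk (j + 1)) := by
    intro j hj
    unfold knotSet at hj
    split_ifs at hj
    · exact ⟨hj.1, hj.2.le⟩
    · exact hj
  have hdisj : ∀ j l, j < l → l ≤ k → t ∈ knotSet tk k j → t ∈ knotSet tk k l → False := by
    intro j l hjl hl h1 h2
    rw [knotSet, if_pos (by omega)] at h1
    have := (hsub l h2).1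
    have := knots_le hmono (show j + 1 ≤ l by omega) (by omega)
    linarith [h1.2]
  refine ⟨i, hik, hsub i hi, ?_⟩
  unfold spline
  rw [Finset.sum_eq_single i]
  · exact Set.indicator_of_mem hi _
  · intro j hj hji
    have hj := Finset.mem_range.1 hj
    refine Set.indicator_of_notMem (fun h => ?_) _
    rcases lt_or_gt_of_ne hji with h' | h'
    · exact hdisj j i h' hik h hi
    · exact hdisj i j h' (by omega) hi h
  · intro h
    exact absurd (Finset.mem_range.2 (by omega)) h

/-- Existence of a Bernstein-spline fixed-point approximation to the Hilfer FIVP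
(Theorem: Hilfer derivative spline approximations). -/
theorem stmt8 (α β γ ε T : ℝ) (hα0 : 0 < α) (hα1 : α < 1) (hβ0 : 0 ≤ β) (hβ1 : β ≤ 1)
    (hγ : γ = α + β - α * β) (hε : 0 < ε) (hεT : ε < T)
    (q : ℕ) (hq : 1 ≤ q) (y₀ : ℝ)
    (k : ℕ) (tk : ℕ → ℝ) (h0 : tk 0 = ε) (hend : tk (k + 1) = T)
    (hmono : ∀ i ≤ k, tk i < tk (i + 1))
    (K : ℝ) (hK : 0 ≤ K)
    (f : ℝ → ℝ → ℝ)
    (hfc : ∀ y : ℝ → ℝ, ContinuousOn (fun t => t ^ (1 - γ) * y t) (Set.Icc 0 T) →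
      ContinuousOn (fun t => t ^ (1 - γ) * f t (y t)) (Set.Icc 0 T))
    (hLip : ∀ t y₁ y₂, |f t y₁ - f t y₂| ≤ K * |y₁ - y₂|)
    (hcontract : ∀ i ≤ k,
      (1 + (tk (i + 1) - tk i) / tk i) ^ (1 - γ) *
        ((5 / 2 * ((tk (i + 1) - tk i) / Real.sqrt q) ^ α + (tk (i + 1) - tk i) ^ α) /
          Real.Gamma (α + 1)) * K < 1) :
    ∃ y : ℝ → ℝ, ContinuousOn (fun t => t ^ (1 - γ) * y t) (Set.Icc ε T) ∧
      ∀ t ∈ Set.Icc ε T,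
        y t = y₀ / Real.Gamma γ * t ^ (γ - 1) +
          spline tk k q (rlInt ε α (fun s => f s (y s))) t := by
  have hγ1 : γ ≤ 1 := by nlinarith [mul_nonneg (sub_nonneg.2 hα1.le) (sub_nonneg.2 hβ1)]
  set C : ℝ → ℝ := fun t => y₀ / Real.Gamma γ * t ^ (γ - 1) with hCdef
  have hpow : ∀ r : ℝ, ContinuousOn (fun t : ℝ => t ^ r) (Set.Icc ε T) := fun r t ht =>
    (Real.continuousAt_rpow_const t _ (Or.inl (by linarith [ht.1]))).continuousWithinAt
  have hC : ContinuousOn C (Set.Icc ε T) := continuousOn_const.mul (hpow _)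
  have hle : ∀ i ≤ k + 1, ε ≤ tk i ∧ tk i ≤ T := fun i hi => by
    rw [← h0, ← hend]
    exact ⟨knots_le hmono (Nat.zero_le i) hi, knots_le hmono hi le_rfl⟩
  have main : ∀ m ≤ k + 1, ∃ y : ℝ → ℝ, ContinuousOn y (Set.Icc ε (tk m)) ∧
      y (tk m) = C (tk m) + rlInt ε α (fun s => f s (y s)) (tk m) ∧
      ∀ i < m, ∀ t ∈ Set.Icc (tk i) (tk (i + 1)),
        y t = C t + bern (tk i) (tk (i + 1)) q (rlInt ε α (fun s => f s (y s))) t := by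
    intro m
    induction m with
    | zero =>
      intro _
      refine ⟨fun _ => C ε, continuousOn_const, ?_, fun i hi => absurd hi (Nat.not_lt_zero i)⟩
      simp [rlInt, h0]
    | succ m ih =>
      intro hm
      obtain ⟨y, hyc, hyb, hyp⟩ := ih (by omega)
      have hbd := hmono m (by omega)
      have hb := hle m (by omega)
      have hd := hle (m + 1) hm
      have hcm := hcontract m (by omega)
      have hc : (tk (m + 1) - tk m) ^ α / Real.Gamma (α + 1) * K < 1 := by
        refine lt_of_le_of_lt (mul_le_mul_of_nonneg_right ?_ hK) hcm
        have hG : 0 < Real.Gamma (α + 1) := Real.Gamma_pos_of_pos (by linarith)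
        have hh : 0 ≤ tk (m + 1) - tk m := by linarith
        have ht : 0 < tk m := by linarith [hb.1]
        have h1 : 1 ≤ (1 + (tk (m + 1) - tk m) / tk m) ^ (1 - γ) := by
          refine Real.one_le_rpow ?_ (by linarith)
          have : 0 ≤ (tk (m + 1) - tk m) / tk m := by positivity
          linarith
        have h2 : (tk (m + 1) - tk m) ^ α / Real.Gamma (α + 1) ≤
            (5 / 2 * ((tk (m + 1) - tk m) / Real.sqrt q) ^ α + (tk (m + 1) - tk m) ^ α) /
              Real.Gamma (α + 1) := by
          gcongr
          have : 0 ≤ 5 / 2 * ((tk (m + 1) - tk m) / Real.sqrt q) ^ α := by positivity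
          linarith
        refine h2.trans (le_mul_of_one_le_left ?_ h1)
        positivity
      obtain ⟨y', hy1, hy2, hy3⟩ := extend_step hα0 hK hb.1 hbd hq f
        (fun a a' ha haa' ha' y hy => f_cont hγ1 f hfc (by linarith) haa' (ha'.trans hd.2) hy)
        hLip hc C (hC.mono (Set.Icc_subset_Icc_right hd.2)) y hyc hyb
      refine ⟨y', hy2, ?_, fun i hi t ht => ?_⟩
      · rw [hy3 _ ⟨hbd.le, le_rfl⟩, bern_at_right hbd hq]
      · rcases Nat.lt_succ_iff_lt_or_eq.1 hi with hi' | rfl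
        · have hle' : tk (i + 1) ≤ tk m := knots_le hmono (by omega) (by omega)
          have hib := hle i (by omega)
          rw [hy1 t (ht.2.trans hle'), hyp i hi' t ht]
          congr 1
          refine bern_congr (hmono i (by omega)) hq (fun x hx => ?_) t
          refine rlInt_congr (hib.1.trans hx.1) fun s hs => ?_
          rw [hy1 s (hs.2.trans (hx.2.trans hle'))]
        · exact hy3 t ht
  obtain ⟨y, hyc, -, hyp⟩ := main (k + 1) le_rfl
  rw [hend] at hyc
  refine ⟨y, (hpow _).mul hyc, fun t ht => ?_⟩
  obtain ⟨i, hi, hti, hs⟩ := spline_eq hmono q (rlInt ε α (fun s => f s (y s)))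
    (t := t) (by rwa [h0, hend])
  rw [hs]
  exact hyp i (by omega) t hti
end

section
/- Let 0 < α < 1, 0 < γ ≤ 1, 0 < ε ≤ t ≤ T, and let f : (0,T] → ℝ be measurable with M = sup_{s∈(0,T]} s^(1−γ)|f(s)| < ∞. Then t^(1−γ) · |(1/Γ(α)) ∫_0^ε (t−s)^(α−1) f(s) ds| ≤ (t^α/Γ(α)) · B_{ε/t}(γ, α) · M, where B_z(γ,α) = ∫_0^z θ^(γ−1)(1−θ)^(α−1) dθ is the incomplete beta function. -/
/-- Incomplete beta function `B_z(a,b) = ∫_0^z θ^(a-1) (1-θ)^(b-1) dθ`. -/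
noncomputable def betaInc (z a b : ℝ) : ℝ :=
  ∫ θ in (0:ℝ)..z, θ ^ (a - 1) * (1 - θ) ^ (b - 1)

theorem beta_intervalIntegrable (a b : ℝ) (ha : 0 < a) (hb : 0 < b) :
    IntervalIntegrable (fun θ : ℝ => θ ^ (a - 1) * (1 - θ) ^ (b - 1)) MeasureTheory.volume 0 1 := by
  have h := (Complex.betaIntegral_convergent (u := (a : ℂ)) (v := (b : ℂ))
    (by simpa using ha) (by simpa using hb)).norm
  refine h.congr ?_
  intro x hx
  rw [Set.uIoc_of_le zero_le_one] at hx
  have e1 : (x : ℂ) ^ ((a : ℂ) - 1) = ((x ^ (a - 1) : ℝ) : ℂ) := by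
    rw [Complex.ofReal_cpow hx.1.le]; push_cast; rfl
  have e2 : (1 - (x : ℂ)) ^ ((b : ℂ) - 1) = (((1 - x) ^ (b - 1) : ℝ) : ℂ) := by
    rw [Complex.ofReal_cpow (by linarith [hx.2])]; push_cast; rfl
  have p1 : 0 ≤ x ^ (a - 1) := Real.rpow_nonneg hx.1.le _
  have p2 : 0 ≤ (1 - x) ^ (b - 1) := Real.rpow_nonneg (by linarith [hx.2]) _
  simp only [e1, e2, norm_mul, Complex.norm_real, Real.norm_of_nonneg p1, Real.norm_of_nonneg p2]

/-- Weighted bound on the fractional integral over the initial segment `[0, ε]`. -/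
theorem stmt11 (α γ ε t T : ℝ) (hα0 : 0 < α) (hα1 : α < 1) (hγ0 : 0 < γ) (hγ1 : γ ≤ 1)
    (hε : 0 < ε) (hεt : ε ≤ t) (htT : t ≤ T)
    (f : ℝ → ℝ) (hmeas : Measurable f)
    (M : ℝ)
    (hMbdd : BddAbove ((fun s => s ^ (1 - γ) * |f s|) '' Set.Ioc (0:ℝ) T))
    (hM : M = sSup ((fun s => s ^ (1 - γ) * |f s|) '' Set.Ioc (0:ℝ) T)) :
    t ^ (1 - γ) * |(1 / Real.Gamma α) * ∫ s in (0:ℝ)..ε, (t - s) ^ (α - 1) * f s| ≤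
      t ^ α / Real.Gamma α * betaInc (ε / t) γ α * M := by
  have ht : 0 < t := hε.trans_le hεt
  have hG : 0 < Real.Gamma α := Real.Gamma_pos_of_pos hα0
  have hz1 : ε / t ≤ 1 := (div_le_one ht).2 hεt
  have hz0 : 0 ≤ ε / t := by positivity
  set g : ℝ → ℝ := fun s => s ^ (γ - 1) * (t - s) ^ (α - 1) with hg
  set h : ℝ → ℝ := fun θ => θ ^ (γ - 1) * (1 - θ) ^ (α - 1) with hh
  have hint : IntervalIntegrable h MeasureTheory.volume 0 (ε / t) := by
    refine (beta_intervalIntegrable γ α hγ0 hα0).mono_set ?_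
    rw [Set.uIcc_of_le hz0, Set.uIcc_of_le zero_le_one]
    exact Set.Icc_subset_Icc le_rfl hz1
  have hpt : ∀ s ∈ Set.Icc 0 ε, t ^ (γ + α - 2) * h (s / t) = g s := by
    intro s hs
    have hst : 1 - s / t = (t - s) / t := by field_simp
    simp only [hh, hg, hst]
    rw [Real.div_rpow hs.1 ht.le, Real.div_rpow (by linarith [hs.2]) ht.le,
      show γ + α - 2 = (γ - 1) + (α - 1) by ring, Real.rpow_add ht]
    have := Real.rpow_pos_of_pos ht (γ - 1)
    have := Real.rpow_pos_of_pos ht (α - 1)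
    field_simp
  have hgint : IntervalIntegrable g MeasureTheory.volume 0 ε := by
    have h1 : IntervalIntegrable (fun s => h (s / t)) MeasureTheory.volume 0 ε := by
      have := hint.comp_mul_right (c := t⁻¹)
      simpa [div_eq_mul_inv, ht.ne'] using this
    refine (h1.const_mul (t ^ (γ + α - 2))).congr ?_
    intro s hs
    rw [Set.uIoc_of_le hε.le] at hs
    exact hpt s ⟨hs.1.le, hs.2⟩
  have hgval : ∫ s in (0:ℝ)..ε, g s = t ^ (γ + α - 1) * betaInc (ε / t) γ α := by
    have e : ∫ s in (0:ℝ)..ε, g s = ∫ s in (0:ℝ)..ε, t ^ (γ + α - 2) * h (s / t) := by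
      refine intervalIntegral.integral_congr ?_
      intro s hs
      rw [Set.uIcc_of_le hε.le] at hs
      exact (hpt s hs).symm
    rw [e, intervalIntegral.integral_const_mul, intervalIntegral.integral_comp_div _ ht.ne',
      zero_div, smul_eq_mul, ← mul_assoc]
    congr 1
    rw [show γ + α - 1 = (γ + α - 2) + 1 by ring, Real.rpow_add ht, Real.rpow_one]
  have hb : ‖∫ s in (0:ℝ)..ε, (t - s) ^ (α - 1) * f s‖ ≤ ∫ s in (0:ℝ)..ε, M * g s := by
    refine intervalIntegral.norm_integral_le_of_norm_le hε.le ?_ (hgint.const_mul M)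
    refine Filter.Eventually.of_forall fun s hs => ?_
    have hsM : s ^ (1 - γ) * |f s| ≤ M := by
      rw [hM]
      exact le_csSup hMbdd ⟨s, ⟨hs.1, hs.2.trans (hεt.trans htT)⟩, rfl⟩
    have p2 : 0 ≤ (t - s) ^ (α - 1) := Real.rpow_nonneg (by linarith [hs.2]) _
    have p1 : 0 < s ^ (γ - 1) := Real.rpow_pos_of_pos hs.1 _
    have e1 : s ^ (γ - 1) * s ^ (1 - γ) = 1 := by
      rw [← Real.rpow_add hs.1]; simp
    have hf : |f s| ≤ s ^ (γ - 1) * M := by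
      calc |f s| = s ^ (γ - 1) * (s ^ (1 - γ) * |f s|) := by rw [← mul_assoc, e1, one_mul]
        _ ≤ _ := mul_le_mul_of_nonneg_left hsM p1.le
    rw [norm_mul, Real.norm_of_nonneg p2, Real.norm_eq_abs]
    calc _ ≤ (t - s) ^ (α - 1) * (s ^ (γ - 1) * M) := mul_le_mul_of_nonneg_left hf p2
      _ = M * g s := by simp only [hg]; ring
  rw [intervalIntegral.integral_const_mul, hgval, Real.norm_eq_abs] at hb
  rw [abs_mul, abs_of_pos (by positivity : 0 < 1 / Real.Gamma α)]
  have hta : t ^ α = t ^ (1 - γ) * t ^ (γ + α - 1) := by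
    rw [← Real.rpow_add ht]; congr 1; ring
  have hc : 0 ≤ t ^ (1 - γ) * (1 / Real.Gamma α) := by positivity
  calc _ = t ^ (1 - γ) * (1 / Real.Gamma α) * |∫ s in (0:ℝ)..ε, (t - s) ^ (α - 1) * f s| := by ring
    _ ≤ _ := mul_le_mul_of_nonneg_left hb hc
    _ = _ := by rw [hta]; ring
end

section
/- Let α > 0, let ℓ ∈ ℕ, let 0 ≤ ε ≤ t_i < t_{i+1}, and let t > t_i with t ≥ ε. Define s_i(x) = (x − t_i)/(t_{i+1} − t_i). Then the Riemann–Liouville fractional integral of the locally supported spline basis function satisfies (1/Γ(α)) ∫_ε^t (t−x)^(α−1) · 1_{[t_i, t_{i+1})}(x) · s_i(x)^ℓ dx = ((t − t_i)^(α+ℓ) / ((t_{i+1} − t_i)^ℓ · Γ(α))) · B_{min(1, 1/s_i(t))}(ℓ+1, α), where B_z(a,b) = ∫_0^z θ^(a−1)(1−θ)^(b−1) dθ is the incomplete beta function. -/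
/-- Closed-form fractional integral of a locally supported spline basis monomial. -/
theorem stmt14 (α : ℝ) (hα : 0 < α) (ℓ : ℕ) (ε ti ti1 t : ℝ)
    (hε : 0 ≤ ε) (hεti : ε ≤ ti) (hti : ti < ti1) (ht : ti < t) (htε : ε ≤ t) :
    (1 / Real.Gamma α) *
        ∫ x in ε..t, (t - x) ^ (α - 1) *
          (Set.Ico ti ti1).indicator (fun x => ((x - ti) / (ti1 - ti)) ^ ℓ) x =
      (t - ti) ^ (α + (ℓ : ℝ)) / ((ti1 - ti) ^ ℓ * Real.Gamma α) *
        betaInc (min 1 (1 / ((t - ti) / (ti1 - ti)))) ((ℓ : ℝ) + 1) α := by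
  have hc : 0 < t - ti := sub_pos.mpr ht
  have hd : 0 < ti1 - ti := sub_pos.mpr hti
  have hG : Real.Gamma α ≠ 0 := (Real.Gamma_pos_of_pos hα).ne'
  have hm : ti ≤ min t ti1 := le_min ht.le hti.le
  have h1 : (∫ x in ε..t, (t - x) ^ (α - 1) *
          (Set.Ico ti ti1).indicator (fun x => ((x - ti) / (ti1 - ti)) ^ ℓ) x)
      = ∫ x in ti..(min t ti1), (t - x) ^ (α - 1) * ((x - ti) / (ti1 - ti)) ^ ℓ := by
    rw [intervalIntegral.integral_of_le htε, intervalIntegral.integral_of_le hm,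
      ← MeasureTheory.integral_indicator measurableSet_Ioc,
      ← MeasureTheory.integral_indicator measurableSet_Ioc]
    apply MeasureTheory.integral_congr_ae
    have e1 : ∀ᵐ x : ℝ, x ≠ ti := by simp [MeasureTheory.ae_iff]
    have e2 : ∀ᵐ x : ℝ, x ≠ ti1 := by simp [MeasureTheory.ae_iff]
    filter_upwards [e1, e2] with x hx1 hx2
    by_cases hx : x ∈ Set.Ioc ti (min t ti1)
    · have hx' := hx
      obtain ⟨ha, hb⟩ := hx'
      rw [le_min_iff] at hb
      have m1 : x ∈ Set.Ioc ε t := ⟨by linarith, hb.1⟩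
      have m2 : x ∈ Set.Ico ti ti1 := ⟨ha.le, lt_of_le_of_ne hb.2 hx2⟩
      rw [Set.indicator_of_mem hx, Set.indicator_of_mem m1, Set.indicator_of_mem m2]
    · rw [Set.indicator_of_notMem hx]
      by_cases hy : x ∈ Set.Ioc ε t
      · rw [Set.indicator_of_mem hy, Set.indicator_of_notMem, mul_zero]
        rintro ⟨ha, hb⟩
        exact hx ⟨lt_of_le_of_ne ha (Ne.symm hx1), le_min hy.2 hb.le⟩
      · rw [Set.indicator_of_notMem hy]
  set z := min 1 (1 / ((t - ti) / (ti1 - ti))) with hz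
  have hz0 : 0 ≤ z := le_min zero_le_one (by positivity)
  have hz1 : z ≤ 1 := min_le_left _ _
  have hcz : (t - ti) * z + ti = min t ti1 := by
    rw [hz, mul_min_of_nonneg _ _ hc.le, min_add]
    congr 1
    · ring
    · field_simp
      ring
  have h2 := intervalIntegral.smul_integral_comp_mul_add (a := 0) (b := z)
    (fun x => (t - x) ^ (α - 1) * ((x - ti) / (ti1 - ti)) ^ ℓ) (t - ti) ti
  rw [hcz, mul_zero, zero_add] at h2
  have h3 : (∫ θ in (0:ℝ)..z, (t - ((t - ti) * θ + ti)) ^ (α - 1) *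
        (((t - ti) * θ + ti - ti) / (ti1 - ti)) ^ ℓ)
      = ((t - ti) ^ (α - 1) * (t - ti) ^ ℓ / (ti1 - ti) ^ ℓ) *
        betaInc z ((ℓ : ℝ) + 1) α := by
    rw [betaInc, ← intervalIntegral.integral_const_mul]
    apply intervalIntegral.integral_congr
    intro θ hθ
    rw [Set.uIcc_of_le hz0] at hθ
    have e : t - ((t - ti) * θ + ti) = (t - ti) * (1 - θ) := by ring
    simp only [e, add_sub_cancel_right, Real.rpow_natCast]
    rw [Real.mul_rpow hc.le (by linarith [hθ.2]), div_pow, mul_pow]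
    ring
  rw [h1, ← h2, h3, smul_eq_mul]
  have h4 : (t - ti) ^ (α + (ℓ : ℝ)) = (t - ti) * (t - ti) ^ (α - 1) * (t - ti) ^ ℓ := by
    rw [Real.rpow_add hc, Real.rpow_natCast, Real.rpow_sub_one hc.ne']
    field_simp
  rw [h4]
  field_simp
end
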